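/- Let I be a directed poset, (D_i)_{i∈I} a system of extended metric spaces with nonexpanding connecting maps f_{ij} : D_i → D_j for i ≤ j (with f_{ii} = id and f_{jk} ∘ f_{ij} = f_{ik}), and let c_i : D_i → C (i ∈ I) be a compatible cocone of nonexpanding maps into an extended metric space C (i.e., c_j ∘ f_{ij} = c_i for i ≤ j). Then the cocone is a colimit — meaning: for every extended metric space Y and every compatible family of nonexpanding maps h_i : D_i → Y (h_j ∘ f_{ij} = h_i) there exists a unique nonexpanding map h : C → Y with h ∘ c_i = h_i for all i — if and only if: (1) C = ⋃_{i∈I} c_i[D_i], and (2) for every i ∈ I and all y, y' ∈ D_i one has d_C(c_i(y), c_i(y')) = inf_{j ≥ i} d_{D_j}(f_{ij}(y), f_{ij}(y')). -/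

import Mathlib

open ENNReal

/-- Truncating a `[0, ∞]`-valued 1-Lipschitz function at a finite level gives a real-valued
nonexpanding function. -/
theorem edist_toReal_min_le {X : Type*} [PseudoEMetricSpace X] {φ : X → ℝ≥0∞}
    (hφ : ∀ x y, φ x ≤ edist x y + φ y) {M : ℝ≥0∞} (hM : M ≠ ⊤) (x y : X) :
    edist (min (φ x) M).toReal (min (φ y) M).toReal ≤ edist x y := by
  have key : ∀ x y, min (φ x) M ≤ edist x y + min (φ y) M := fun x y => by
    rcases le_total (φ y) M with h | h
    · rw [min_eq_left h]
      exact (min_le_left _ _).trans (hφ x y)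
    · rw [min_eq_right h]
      exact (min_le_right _ _).trans le_add_self
  have h₁ := key x y
  have h₂ := key y x
  rw [edist_comm y x] at h₂
  have hx : min (φ x) M ≠ ⊤ := ne_top_of_le_ne_top hM (min_le_right _ _)
  have hy : min (φ y) M ≠ ⊤ := ne_top_of_le_ne_top hM (min_le_right _ _)
  generalize min (φ x) M = a at *
  generalize min (φ y) M = b at *
  generalize edist x y = e at *
  induction e with
  | top => exact le_top
  | coe e =>
    lift a to NNReal using hx
    lift b to NNReal using hy
    norm_cast at h₁ h₂
    rw [edist_dist, ENNReal.ofReal_le_iff_le_toReal ENNReal.coe_ne_top, Real.dist_eq, abs_le]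
    have h₁' : (a : ℝ) ≤ e + b := by exact_mod_cast h₁
    have h₂' : (b : ℝ) ≤ e + a := by exact_mod_cast h₂
    simp only [ENNReal.coe_toReal]
    constructor <;> linarith

section Cocone

universe u v w

variable {I : Type u} [PartialOrder I] {D : I → Type v} [∀ i, EMetricSpace (D i)]
  {f : ∀ i j, i ≤ j → D i → D j} {C : Type v} [EMetricSpace C] {c : ∀ i, D i → C}

/-- The legs of a colimit cocone of extended metric spaces are jointly surjective. -/
theorem exists_leg_eq_of_isColimit
    (hc_ne : ∀ i (x y : D i), edist (c i x) (c i y) ≤ edist x y)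
    (hc_compat : ∀ i j (h : i ≤ j) (x : D i), c j (f i j h x) = c i x)
    (hC : ∀ (Y : Type w) [EMetricSpace Y] (h : ∀ i, D i → Y),
        (∀ i (x y : D i), edist (h i x) (h i y) ≤ edist x y) →
        (∀ i j (hij : i ≤ j) (x : D i), h j (f i j hij x) = h i x) →
        ∃! g : C → Y,
          (∀ x y : C, edist (g x) (g y) ≤ edist x y) ∧ ∀ i (x : D i), g (c i x) = h i x)
    (x₀ : C) : ∃ i, ∃ y : D i, c i y = x₀ := by
  by_contra! hx₀
  have hpos : ∀ i (x : D i), 0 < (min (edist (c i x) x₀) 1).toReal := fun i x =>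
    ENNReal.toReal_pos (by simpa using hx₀ i x)
      (ne_top_of_le_ne_top ENNReal.one_ne_top (min_le_right _ _))
  have hlip := edist_toReal_min_le (X := C) (φ := fun x => edist x x₀)
    (fun x y => edist_triangle x y x₀) ENNReal.one_ne_top
  -- The distance to `x₀` takes positive values on the image, so its extension to `x₀` shows
  -- that `x₀` has positive distance to the image.
  obtain ⟨g, ⟨hg, hgc⟩, -⟩ := hC (ULift.{w} {r : ℝ // 0 < r})
    (fun i x => ⟨⟨_, hpos i x⟩⟩)
    (fun i x y => (hlip (c i x) (c i y)).trans (hc_ne i x y))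
    (fun i j hij x => by simp only [hc_compat])
  have hfar : ∀ i (x : D i), ENNReal.ofReal (g x₀).down.1 ≤ 2 * edist x₀ (c i x) := by
    intro i x
    have h₁ := hg x₀ (c i x)
    rw [hgc] at h₁
    change edist (g x₀).down.1 (min (edist (c i x) x₀) 1).toReal ≤ _ at h₁
    calc ENNReal.ofReal (g x₀).down.1 = edist (g x₀).down.1 0 := by
          rw [edist_dist, Real.dist_eq, sub_zero, abs_of_pos (g x₀).down.2]
      _ ≤ edist (g x₀).down.1 (min (edist (c i x) x₀) 1).toReal
            + edist (min (edist (c i x) x₀) 1).toReal 0 := edist_triangle _ _ _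
      _ ≤ edist x₀ (c i x) + edist x₀ (c i x) := by
          refine add_le_add h₁ ?_
          rw [edist_dist, Real.dist_eq, sub_zero, abs_of_pos (hpos i x), ENNReal.ofReal_toReal
            (ne_top_of_le_ne_top ENNReal.one_ne_top (min_le_right _ _)), edist_comm x₀]
          exact min_le_left _ _
      _ = 2 * edist x₀ (c i x) := (two_mul _).symm
  -- The zero map and the truncated distance to the image agree on the image.
  let φ : C → ℝ≥0∞ := fun x => ⨅ p : Σ i, D i, edist x (c p.1 p.2)
  have hφ : ∀ x y, φ x ≤ edist x y + φ y := fun x y => by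
    simp only [φ, ENNReal.add_iInf]
    exact le_iInf fun p => (iInf_le _ p).trans (edist_triangle _ _ _)
  have hφc : ∀ i (x : D i), φ (c i x) = 0 := fun i x =>
    le_antisymm ((iInf_le _ ⟨i, x⟩).trans (edist_self _).le) zero_le
  have hφ₀ : φ x₀ ≠ 0 := by
    intro h0
    have h₂ : ENNReal.ofReal (g x₀).down.1 ≤ 2 * φ x₀ := by
      rw [ENNReal.mul_iInf_of_ne two_ne_zero ENNReal.ofNat_ne_top]
      exact le_iInf fun p => hfar p.1 p.2
    rw [h0, mul_zero, nonpos_iff_eq_zero, ENNReal.ofReal_eq_zero] at h₂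
    exact absurd (g x₀).down.2 h₂.not_gt
  have huniq := (hC (ULift.{w} ℝ) (fun _ _ => ⟨0⟩) (fun _ _ _ => by simp)
    (fun _ _ _ _ => rfl)).unique (y₁ := fun _ => ⟨0⟩)
    (y₂ := fun x => ⟨(min (φ x) 1).toReal⟩) ⟨fun _ _ => by simp, fun _ _ => rfl⟩
    ⟨edist_toReal_min_le hφ ENNReal.one_ne_top, fun i x => by simp [hφc]⟩
  have h₀ : (0 : ℝ) = (min (φ x₀) 1).toReal := congrArg ULift.down (congrFun huniq x₀)
  exact (ENNReal.toReal_pos (by simpa using hφ₀)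
    (ne_top_of_le_ne_top ENNReal.one_ne_top (min_le_right _ _))).ne h₀

/-- Distances in a directed colimit of extended metric spaces are bounded below by the infimum of
the distances in the system. -/
theorem iInf_edist_le_of_isColimit [IsDirected I (· ≤ ·)]
    (hf_ne : ∀ i j (h : i ≤ j) (x y : D i), edist (f i j h x) (f i j h y) ≤ edist x y)
    (hf_comp : ∀ i j k (hij : i ≤ j) (hjk : j ≤ k) (x : D i),
      f j k hjk (f i j hij x) = f i k (hij.trans hjk) x)
    (hC : ∀ (Y : Type w) [EMetricSpace Y] (h : ∀ i, D i → Y),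
        (∀ i (x y : D i), edist (h i x) (h i y) ≤ edist x y) →
        (∀ i j (hij : i ≤ j) (x : D i), h j (f i j hij x) = h i x) →
        ∃! g : C → Y,
          (∀ x y : C, edist (g x) (g y) ≤ edist x y) ∧ ∀ i (x : D i), g (c i x) = h i x)
    (i : I) (y y' : D i) :
    ⨅ j : {j : I // i ≤ j}, edist (f i j.1 j.2 y) (f i j.1 j.2 y') ≤ edist (c i y) (c i y') := by
  let φ : ∀ k, D k → ℝ≥0∞ := fun k z =>
    ⨅ j : {j : I // k ≤ j ∧ i ≤ j}, edist (f k j.1 j.2.1 z) (f i j.1 j.2.2 y)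
  have hφ : ∀ k (z z' : D k), φ k z ≤ edist z z' + φ k z' := fun k z z' => by
    simp only [φ, ENNReal.add_iInf]
    exact le_iInf fun j => (iInf_le _ j).trans <|
      (edist_triangle _ (f k j.1 j.2.1 z') _).trans <| by gcongr; exact hf_ne _ _ _ _ _
  have hφ_compat : ∀ l k (hlk : l ≤ k) (z : D l), φ k (f l k hlk z) = φ l z := fun l k hlk z => by
    apply le_antisymm
    · refine le_iInf fun ⟨j, hlj, hij⟩ => ?_
      obtain ⟨m, hjm, hkm⟩ := exists_ge_ge j k
      refine (iInf_le _ ⟨m, hkm, hij.trans hjm⟩).trans ?_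
      simpa only [hf_comp] using hf_ne j m hjm (f l j hlj z) (f i j hij y)
    · refine le_iInf fun ⟨j, hkj, hij⟩ => (iInf_le _ ⟨j, hlk.trans hkj, hij⟩).trans ?_
      simp only [hf_comp, le_refl]
  have hφy : φ i y = 0 :=
    le_antisymm ((iInf_le _ ⟨i, le_rfl, le_rfl⟩).trans (edist_self _).le) zero_le
  have hφy' : ⨅ j : {j : I // i ≤ j}, edist (f i j.1 j.2 y) (f i j.1 j.2 y') ≤ φ i y' :=
    le_iInf fun j => (iInf_le _ ⟨j.1, j.2.1⟩).trans (edist_comm _ _).le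
  refine hφy'.trans (ENNReal.le_of_forall_nnreal_lt fun M hM => ?_)
  obtain ⟨g, ⟨hg, hgc⟩, -⟩ := hC (ULift.{w} ℝ) (fun k z => ⟨(min (φ k z) M).toReal⟩)
    (fun k => edist_toReal_min_le (hφ k) ENNReal.coe_ne_top)
    (fun l k hlk z => by simp only [hφ_compat])
  have hgy := hg (c i y) (c i y')
  rw [hgc, hgc, hφy, min_eq_right hM.le] at hgy
  change edist (min (0 : ℝ≥0∞) M).toReal (M : ℝ≥0∞).toReal ≤ _ at hgy
  simpa [edist_dist, Real.dist_eq] using hgy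

/-- A compatible family of nonexpanding maps is bounded by the distances in the vertex of the
cocone, when these are given by the infimum formula. -/
theorem edist_le_edist_of_iInf [IsDirected I (· ≤ ·)]
    (hc_compat : ∀ i j (h : i ≤ j) (x : D i), c j (f i j h x) = c i x)
    (hc_inf : ∀ i (y y' : D i), edist (c i y) (c i y') =
      ⨅ j : {j : I // i ≤ j}, edist (f i j.1 j.2 y) (f i j.1 j.2 y'))
    {Y : Type w} [EMetricSpace Y] {h : ∀ i, D i → Y}
    (hh_ne : ∀ i (x y : D i), edist (h i x) (h i y) ≤ edist x y)
    (hh_compat : ∀ i j (hij : i ≤ j) (x : D i), h j (f i j hij x) = h i x)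
    (i j : I) (x : D i) (y : D j) : edist (h i x) (h j y) ≤ edist (c i x) (c j y) := by
  obtain ⟨k, hik, hjk⟩ := exists_ge_ge i j
  rw [← hc_compat i k hik, ← hc_compat j k hjk, ← hh_compat i k hik, ← hh_compat j k hjk, hc_inf]
  refine le_iInf fun m => ?_
  rw [← hh_compat k m.1 m.2, ← hh_compat k m.1 m.2 (f j k hjk y)]
  exact hh_ne _ _ _

end Cocone

/-- A cocone over a directed system of extended metric spaces with
nonexpanding connecting maps is a colimit (in the category of extended metric spaces
and nonexpanding maps) iff it is collectively surjective and the distances in the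
vertex are computed by the infimum formula. -/
theorem directed_colimit_emetric_characterization.{u, v, w}
    {I : Type u} [PartialOrder I] [IsDirected I (· ≤ ·)] [Nonempty I]
    (D : I → Type v) [∀ i, EMetricSpace (D i)]
    (f : ∀ i j, i ≤ j → D i → D j)
    (hf_ne : ∀ i j (h : i ≤ j) (x y : D i), edist (f i j h x) (f i j h y) ≤ edist x y)
    (hf_id : ∀ i (x : D i), f i i le_rfl x = x)
    (hf_comp : ∀ i j k (hij : i ≤ j) (hjk : j ≤ k) (x : D i),
      f j k hjk (f i j hij x) = f i k (hij.trans hjk) x)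
    (C : Type v) [EMetricSpace C]
    (c : ∀ i, D i → C)
    (hc_ne : ∀ i (x y : D i), edist (c i x) (c i y) ≤ edist x y)
    (hc_compat : ∀ i j (h : i ≤ j) (x : D i), c j (f i j h x) = c i x) :
    (∀ (Y : Type w) [EMetricSpace Y] (h : ∀ i, D i → Y),
        (∀ i (x y : D i), edist (h i x) (h i y) ≤ edist x y) →
        (∀ i j (hij : i ≤ j) (x : D i), h j (f i j hij x) = h i x) →
        ∃! g : C → Y,
          (∀ x y : C, edist (g x) (g y) ≤ edist x y) ∧ ∀ i (x : D i), g (c i x) = h i x)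
    ↔ ((∀ x : C, ∃ i, ∃ y : D i, c i y = x) ∧
       (∀ i (y y' : D i), edist (c i y) (c i y') =
          ⨅ j : {j : I // i ≤ j}, edist (f i j.1 j.2 y) (f i j.1 j.2 y'))) := by
  constructor
  · intro hC
    exact ⟨exists_leg_eq_of_isColimit hc_ne hc_compat hC, fun i y y' => le_antisymm
      (le_iInf fun j => by
        simpa only [hc_compat] using hc_ne j.1 (f i j.1 j.2 y) (f i j.1 j.2 y'))
      (iInf_edist_le_of_isColimit hf_ne hf_comp hC i y y')⟩
  · rintro ⟨hsurj, hc_inf⟩ Y _ h hh_ne hh_compat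
    have key := edist_le_edist_of_iInf hc_compat hc_inf hh_ne hh_compat
    choose i y hy using hsurj
    refine ⟨fun x => h (i x) (y x), ⟨fun x x' => ?_, fun j x => ?_⟩, fun g ⟨_, hg⟩ => ?_⟩
    · simpa only [hy] using key (i x) (i x') (y x) (y x')
    · have := key (i (c j x)) j (y (c j x)) x
      rw [hy, edist_self] at this
      exact edist_le_zero.mp this
    · funext x
      rw [← hg, hy]
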